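/- arXiv:0708.1202 — 7 statements merged into one kernel-verified Lean document; each statement's English description precedes it below -/
import Mathlib

section
/- Let A, B, C be 2×2 complex matrices that are skew-Hermitian (Aᴴ = −A) and traceless. Then [A,[B,C]] = ⟨A,C⟩·B − ⟨A,B⟩·C, where [X,Y] := YX − XY and ⟨X,Y⟩ := −2·tr(XY). -/
open Matrix

noncomputable section

/-- The Lie bracket `[X,Y] := YX − XY`. -/
def bracket (X Y : Matrix (Fin 2) (Fin 2) ℂ) : Matrix (Fin 2) (Fin 2) ℂ := Y * X - X * Y

/-- The trace form `⟨X,Y⟩ := −2·tr(XY)` on skew-Hermitian traceless matrices. -/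
def traceForm (X Y : Matrix (Fin 2) (Fin 2) ℂ) : ℂ := -2 * (X * Y).trace

theorem stmt_3 (A B C : Matrix (Fin 2) (Fin 2) ℂ)
    (hA : Aᴴ = -A) (hB : Bᴴ = -B) (hC : Cᴴ = -C)
    (hA0 : A.trace = 0) (hB0 : B.trace = 0) (hC0 : C.trace = 0) :
    bracket A (bracket B C) = traceForm A C • B - traceForm A B • C := by
  have h {X : Matrix (Fin 2) (Fin 2) ℂ} (hX : X.trace = 0) : X 1 1 = -X 0 0 := by
    rw [trace_fin_two] at hX
    exact eq_neg_of_add_eq_zero_right hX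
  have hA1 := h hA0
  have hB1 := h hB0
  have hC1 := h hC0
  ext i j
  fin_cases i <;> fin_cases j <;>
    simp [bracket, traceForm, mul_apply, trace_fin_two, Fin.sum_univ_two, hA1, hB1, hC1] <;>
    ring
end
end

section
/- Let g : ℝ² → M₂(ℂ) be a smooth map with det g(s,t) = 1 for all (s,t), and define Λ(s,t) = g(s,t)⁻¹·(∂g/∂s)(s,t) and V(s,t) = g(s,t)⁻¹·(∂g/∂t)(s,t). If Λ(s,t) and V(s,t) are Hermitian matrices for all (s,t), then (∂Λ/∂t)(s,t) = (∂V/∂s)(s,t) for all (s,t). -/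
open Matrix

noncomputable section

attribute [local instance] Matrix.normedAddCommGroup Matrix.normedSpace

lemma hasDerivAt_matrix_iff {m n : Type*} [Fintype m] [Fintype n]
    {A : ℝ → Matrix m n ℂ} {A' : Matrix m n ℂ} {x : ℝ} :
    HasDerivAt A A' x ↔ ∀ i j, HasDerivAt (fun y => A y i j) (A' i j) x :=
  hasDerivAt_pi.trans (forall_congr' fun _ => hasDerivAt_pi)

lemma HasDerivAt.matrix_mul {l m n : Type*} [Fintype l] [Fintype m] [Fintype n]
    {A : ℝ → Matrix l m ℂ} {B : ℝ → Matrix m n ℂ} {A' : Matrix l m ℂ} {B' : Matrix m n ℂ} {x : ℝ}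
    (hA : HasDerivAt A A' x) (hB : HasDerivAt B B' x) :
    HasDerivAt (fun y => A y * B y) (A' * B x + A x * B') x := by
  rw [hasDerivAt_matrix_iff] at hA hB ⊢
  intro i j
  simp only [Matrix.add_apply, Matrix.mul_apply, ← Finset.sum_add_distrib]
  exact HasDerivAt.fun_sum fun k _ => (hA i k).mul (hB k j)

lemma HasDerivAt.matrix_conjTranspose {m n : Type*} [Fintype m] [Fintype n]
    {A : ℝ → Matrix m n ℂ} {A' : Matrix m n ℂ} {x : ℝ} (hA : HasDerivAt A A' x) :
    HasDerivAt (fun y => (A y)ᴴ) A'ᴴ x := by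
  rw [hasDerivAt_matrix_iff] at hA ⊢
  exact fun i j => (hA j i).star

lemma HasDerivAt.matrix_adjugate_fin_two
    {A : ℝ → Matrix (Fin 2) (Fin 2) ℂ} {A' : Matrix (Fin 2) (Fin 2) ℂ} {x : ℝ}
    (hA : HasDerivAt A A' x) :
    HasDerivAt (fun y => (A y).adjugate) A'.adjugate x := by
  rw [hasDerivAt_matrix_iff] at hA ⊢
  simp only [Matrix.adjugate_fin_two]
  intro i j
  fin_cases i <;> fin_cases j
  · exact hA 1 1
  · exact (hA 0 1).neg
  · exact (hA 1 0).neg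
  · exact hA 0 0

/-- The derivative of a differentiable curve of Hermitian matrices is Hermitian. -/
lemma HasDerivAt.isHermitian {n : Type*} [Fintype n]
    {A : ℝ → Matrix n n ℂ} {A' : Matrix n n ℂ} {x : ℝ}
    (hA : HasDerivAt A A' x) (h : ∀ y, (A y).IsHermitian) : A'.IsHermitian := by
  have hstar := hA.matrix_conjTranspose
  simp only [fun y => (h y).eq] at hstar
  exact hstar.unique hA

section Slices

variable {E : Type*} [NormedAddCommGroup E] [NormedSpace ℝ E] {F : ℝ × ℝ → E} {s t : ℝ}

lemma DifferentiableAt.hasDerivAt_fst_slice (h : DifferentiableAt ℝ F (s, t)) :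
    HasDerivAt (fun s' => F (s', t)) (fderiv ℝ F (s, t) (1, 0)) s :=
  h.hasFDerivAt.comp_hasDerivAt s ((hasDerivAt_id s).prodMk (hasDerivAt_const s t))

lemma DifferentiableAt.hasDerivAt_snd_slice (h : DifferentiableAt ℝ F (s, t)) :
    HasDerivAt (fun t' => F (s, t')) (fderiv ℝ F (s, t) (0, 1)) t :=
  h.hasFDerivAt.comp_hasDerivAt t ((hasDerivAt_const t s).prodMk (hasDerivAt_id t))

/-- Both first partial derivatives of a `C²` function of two variables are differentiable in the
other variable, with the same mixed second derivative. -/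
lemma ContDiff.exists_mixed_hasDerivAt (hF : ContDiff ℝ 2 F) (s t : ℝ) :
    ∃ M : E, HasDerivAt (fun t' => deriv (fun s' => F (s', t')) s) M t ∧
      HasDerivAt (fun s' => deriv (fun t' => F (s', t')) t) M s := by
  have hd : Differentiable ℝ F := hF.differentiable (by norm_num)
  have hd' : Differentiable ℝ (fderiv ℝ F) :=
    (hF.fderiv_right (m := 1) (by norm_num)).differentiable (by norm_num)
  have hsymm : IsSymmSndFDerivAt ℝ F (s, t) :=
    hF.contDiffAt.isSymmSndFDerivAt (by simp)
  refine ⟨fderiv ℝ (fderiv ℝ F) (s, t) (0, 1) (1, 0), ?_, ?_⟩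
  · simp only [fun t' => (hd (s, t')).hasDerivAt_fst_slice.deriv]
    simpa using (hd' (s, t)).hasDerivAt_snd_slice.clm_apply (hasDerivAt_const t ((1, 0) : ℝ × ℝ))
  · simp only [fun s' => (hd (s', t)).hasDerivAt_snd_slice.deriv]
    rw [hsymm]
    simpa using (hd' (s, t)).hasDerivAt_fst_slice.clm_apply (hasDerivAt_const s ((0, 1) : ℝ × ℝ))

end Slices

/-- If the difference of two Hermitian matrices `L` and `W` is a commutator of Hermitian matrices,
then they are equal. -/
lemma Matrix.IsHermitian.eq_of_sub_eq_commutator {n : Type*} [Fintype n]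
    {A B L W : Matrix n n ℂ} (hA : A.IsHermitian) (hB : B.IsHermitian)
    (hL : L.IsHermitian) (hW : W.IsHermitian) (h : L - W = A * B - B * A) : L = W := by
  have hstar := congrArg (fun X => Xᴴ) h
  simp only [conjTranspose_sub, conjTranspose_mul, hA.eq, hB.eq, hL.eq, hW.eq] at hstar
  rw [← neg_sub (A * B), ← h] at hstar
  refine sub_eq_zero.mp (Matrix.ext fun i j => ?_)
  exact self_eq_neg.mp (congrFun (congrFun hstar i) j)

theorem stmt_9 (g : ℝ → ℝ → Matrix (Fin 2) (Fin 2) ℂ)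
    (hg : ContDiff ℝ (⊤ : ℕ∞) (fun p : ℝ × ℝ => g p.1 p.2))
    (hdet : ∀ s t, (g s t).det = 1)
    (Λ V : ℝ → ℝ → Matrix (Fin 2) (Fin 2) ℂ)
    (hΛ : ∀ s t, Λ s t = (g s t)⁻¹ * deriv (fun s' => g s' t) s)
    (hV : ∀ s t, V s t = (g s t)⁻¹ * deriv (fun t' => g s t') t)
    (hΛherm : ∀ s t, (Λ s t).IsHermitian)
    (hVherm : ∀ s t, (V s t).IsHermitian) :
    ∀ s t, deriv (fun t' => Λ s t') t = deriv (fun s' => V s' t) s := by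
  intro s t
  have hunit : ∀ s t, IsUnit (g s t).det := fun s t => by simp [hdet]
  have hinv : ∀ s t, (g s t)⁻¹ = (g s t).adjugate := fun s t => by
    simp [Matrix.inv_def, hdet]
  have hgs : ∀ s t, deriv (fun s' => g s' t) s = g s t * Λ s t := fun s t => by
    rw [hΛ, mul_nonsing_inv_cancel_left _ _ (hunit s t)]
  have hgt : ∀ s t, deriv (fun t' => g s t') t = g s t * V s t := fun s t => by
    rw [hV, mul_nonsing_inv_cancel_left _ _ (hunit s t)]
  have hd : DifferentiableAt ℝ (fun p : ℝ × ℝ => g p.1 p.2) (s, t) :=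
    hg.differentiable (by simp) _
  have hs : HasDerivAt (fun s' => g s' t) (g s t * Λ s t) s :=
    hgs s t ▸ hd.hasDerivAt_fst_slice.differentiableAt.hasDerivAt
  have ht : HasDerivAt (fun t' => g s t') (g s t * V s t) t :=
    hgt s t ▸ hd.hasDerivAt_snd_slice.differentiableAt.hasDerivAt
  obtain ⟨M, hMt, hMs⟩ := (contDiff_infty.mp hg 2).exists_mixed_hasDerivAt s t
  obtain ⟨L, hL⟩ : ∃ L, HasDerivAt (fun t' => Λ s t') L t := by
    simp only [hΛ, hinv]
    exact ⟨_, ht.matrix_adjugate_fin_two.matrix_mul hMt⟩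
  obtain ⟨W, hW⟩ : ∃ W, HasDerivAt (fun s' => V s' t) W s := by
    simp only [hV, hinv]
    exact ⟨_, hs.matrix_adjugate_fin_two.matrix_mul hMs⟩
  have hMt' : HasDerivAt (fun t' => g s t' * Λ s t') M t := by
    simp only [← hgs]
    exact hMt
  have hMs' : HasDerivAt (fun s' => g s' t * V s' t) M s := by
    simp only [← hgt]
    exact hMs
  have hmixed : g s t * V s t * Λ s t + g s t * L = g s t * Λ s t * V s t + g s t * W :=
    ((ht.matrix_mul hL).unique hMt').trans ((hs.matrix_mul hW).unique hMs').symm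
  have hcurv : L - W = Λ s t * V s t - V s t * Λ s t := by
    have h : V s t * Λ s t + L = Λ s t * V s t + W := by
      have := congrArg ((g s t)⁻¹ * ·) hmixed
      simpa only [Matrix.mul_assoc, ← Matrix.mul_add,
        nonsing_inv_mul_cancel_left _ _ (hunit s t)] using this
    rw [sub_eq_sub_iff_add_eq_add, add_comm, h]
  have hLW : L = W := (hΛherm s t).eq_of_sub_eq_commutator (hVherm s t)
    (hL.isHermitian fun t' => hΛherm s t') (hW.isHermitian fun s' => hVherm s' t) hcurv
  exact hL.deriv.trans (hLW.trans hW.deriv.symm)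
end
end

section
/- Let ε ∈ ℝ and let (h₁,h₂,h₃,H₁,H₂,H₃) : ℝ → ℝ⁶ be a differentiable solution of the system: dH₁/ds = 0, dH₂/ds = −H₃H₁ + h₃, dH₃/ds = H₂H₁ − h₂, dh₁/ds = H₃h₂ − H₂h₃, dh₂/ds = −H₃h₁ + εH₃, dh₃/ds = H₂h₁ − εH₂. Then the functions H := (1/2)(H₂² + H₃²) + h₁, I₁ := h₁² + h₂² + h₃² + ε(H₁² + H₂² + H₃²), and I₂ := h₁H₁ + h₂H₂ + h₃H₃ are constant along the solution. -/
noncomputable section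

theorem eq_of_hasDerivAt_zero {f f' : ℝ → ℝ} (hf : ∀ s, HasDerivAt f (f' s) s)
    (hf' : ∀ s, f' s = 0) (s₁ s₂ : ℝ) : f s₁ = f s₂ :=
  is_const_of_deriv_eq_zero (fun s => (hf s).differentiableAt)
    (fun s => (hf s).deriv.trans (hf' s)) s₁ s₂

theorem stmt_13 (ε : ℝ) (h₁ h₂ h₃ H₁ H₂ H₃ : ℝ → ℝ)
    (hH₁ : ∀ s, HasDerivAt H₁ 0 s)
    (hH₂ : ∀ s, HasDerivAt H₂ (-(H₃ s * H₁ s) + h₃ s) s)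
    (hH₃ : ∀ s, HasDerivAt H₃ (H₂ s * H₁ s - h₂ s) s)
    (hh₁ : ∀ s, HasDerivAt h₁ (H₃ s * h₂ s - H₂ s * h₃ s) s)
    (hh₂ : ∀ s, HasDerivAt h₂ (-(H₃ s * h₁ s) + ε * H₃ s) s)
    (hh₃ : ∀ s, HasDerivAt h₃ (H₂ s * h₁ s - ε * H₂ s) s) :
    ∀ s₁ s₂,
      ((1 / 2) * (H₂ s₁ ^ 2 + H₃ s₁ ^ 2) + h₁ s₁
        = (1 / 2) * (H₂ s₂ ^ 2 + H₃ s₂ ^ 2) + h₁ s₂)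
      ∧ (h₁ s₁ ^ 2 + h₂ s₁ ^ 2 + h₃ s₁ ^ 2 + ε * (H₁ s₁ ^ 2 + H₂ s₁ ^ 2 + H₃ s₁ ^ 2)
        = h₁ s₂ ^ 2 + h₂ s₂ ^ 2 + h₃ s₂ ^ 2 + ε * (H₁ s₂ ^ 2 + H₂ s₂ ^ 2 + H₃ s₂ ^ 2))
      ∧ (h₁ s₁ * H₁ s₁ + h₂ s₁ * H₂ s₁ + h₃ s₁ * H₃ s₁
        = h₁ s₂ * H₁ s₂ + h₂ s₂ * H₂ s₂ + h₃ s₂ * H₃ s₂) := by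
  intro s₁ s₂
  refine ⟨?_, ?_, ?_⟩
  · exact eq_of_hasDerivAt_zero
      (fun s => ((((hH₂ s).fun_pow 2).fun_add ((hH₃ s).fun_pow 2)).const_mul (1 / 2)).fun_add (hh₁ s))
      (fun s => by push_cast; ring) s₁ s₂
  · exact eq_of_hasDerivAt_zero
      (fun s => ((((hh₁ s).fun_pow 2).fun_add ((hh₂ s).fun_pow 2)).fun_add
        ((hh₃ s).fun_pow 2)).fun_add
        (((((hH₁ s).fun_pow 2).fun_add ((hH₂ s).fun_pow 2)).fun_add
          ((hH₃ s).fun_pow 2)).const_mul ε))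
      (fun s => by push_cast; ring) s₁ s₂
  · exact eq_of_hasDerivAt_zero
      (fun s => (((hh₁ s).fun_mul (hH₁ s)).fun_add ((hh₂ s).fun_mul (hH₂ s))).fun_add
        ((hh₃ s).fun_mul (hH₃ s)))
      (fun s => by ring) s₁ s₂
end
end

section
/- Let ε ∈ ℝ and let (h₁,h₂,h₃,H₁,H₂,H₃) : ℝ → ℝ⁶ be a differentiable solution of the system: dH₁/ds = 0, dH₂/ds = −H₃H₁ + h₃, dH₃/ds = H₂H₁ − h₂, dh₁/ds = H₃h₂ − H₂h₃, dh₂/ds = −H₃h₁ + εH₃, dh₃/ds = H₂h₁ − εH₂. Let H := (1/2)(H₂² + H₃²) + h₁, I₁ := h₁² + h₂² + h₃² + ε(H₁² + H₂² + H₃²), I₂ := h₁H₁ + h₂H₂ + h₃H₃ (all constant along the solution). Then for all s: (dh₁/ds(s))² = 2(H − h₁(s))·(I₁ − ε·H₁² − 2ε(H − h₁(s)) − h₁(s)²) − (I₂ − h₁(s)·H₁)²; in particular (dh₁/ds)² is a cubic polynomial in h₁ with coefficients constant along the solution. -/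
noncomputable section

theorem stmt_14 (ε : ℝ) (h₁ h₂ h₃ H₁ H₂ H₃ : ℝ → ℝ)
    (hH₁ : ∀ s, HasDerivAt H₁ 0 s)
    (hH₂ : ∀ s, HasDerivAt H₂ (-(H₃ s * H₁ s) + h₃ s) s)
    (hH₃ : ∀ s, HasDerivAt H₃ (H₂ s * H₁ s - h₂ s) s)
    (hh₁ : ∀ s, HasDerivAt h₁ (H₃ s * h₂ s - H₂ s * h₃ s) s)
    (hh₂ : ∀ s, HasDerivAt h₂ (-(H₃ s * h₁ s) + ε * H₃ s) s)
    (hh₃ : ∀ s, HasDerivAt h₃ (H₂ s * h₁ s - ε * H₂ s) s)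
    -- the constants of motion: `a` is the (constant) value of `H₁`, and `H`, `I₁`, `I₂`
    -- are the common values of the conserved quantities along the solution
    (a H I₁ I₂ : ℝ)
    (ha : ∀ s, H₁ s = a)
    (hH : ∀ s, (1 / 2) * (H₂ s ^ 2 + H₃ s ^ 2) + h₁ s = H)
    (hI₁ : ∀ s, h₁ s ^ 2 + h₂ s ^ 2 + h₃ s ^ 2 + ε * (H₁ s ^ 2 + H₂ s ^ 2 + H₃ s ^ 2) = I₁)
    (hI₂ : ∀ s, h₁ s * H₁ s + h₂ s * H₂ s + h₃ s * H₃ s = I₂) :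
    ∀ s, (deriv h₁ s) ^ 2
      = 2 * (H - h₁ s) * (I₁ - ε * a ^ 2 - 2 * ε * (H - h₁ s) - h₁ s ^ 2)
        - (I₂ - h₁ s * a) ^ 2 := by
  intro s
  rw [(hh₁ s).deriv, ← hH s, ← hI₁ s, ← hI₂ s, ← ha s]
  ring
end
end

section
/- Let E be a real inner product space, L > 0, and let γ : ℝ → E be a smooth curve that is L-periodic (γ(s+L) = γ(s) for all s) and satisfies ⟨γ(s),γ(s)⟩ constant in s. Then ∫₀ᴸ ( 2⟨γ'''(s),γ''(s)⟩ − 2⟨γ(s),γ'''(s)⟩·⟨γ(s),γ''(s)⟩ − 3⟨γ(s),γ''(s)⟩·⟨γ'(s),γ''(s)⟩ ) ds = 0. -/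
open scoped RealInnerProductSpace

noncomputable section

theorem ContDiff.deriv_of_top {E : Type*} [NormedAddCommGroup E] [NormedSpace ℝ E]
    {f : ℝ → E} (hf : ContDiff ℝ (⊤ : ℕ∞) f) : ContDiff ℝ (⊤ : ℕ∞) (deriv f) :=
  (contDiff_infty_iff_deriv.mp hf).2

theorem Function.Periodic.deriv_periodic {E : Type*} [NormedAddCommGroup E] [NormedSpace ℝ E]
    {f : ℝ → E} {c : ℝ} (hf : Function.Periodic f c) : Function.Periodic (deriv f) c := by
  intro s
  rw [← deriv_comp_add_const, funext hf]

theorem stmt_17 (E : Type*) [NormedAddCommGroup E] [InnerProductSpace ℝ E]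
    (L : ℝ) (hL : 0 < L) (γ : ℝ → E)
    (hγ : ContDiff ℝ (⊤ : ℕ∞) γ)
    (hper : ∀ s, γ (s + L) = γ s)
    (hconst : ∀ s s', ⟪γ s, γ s⟫ = ⟪γ s', γ s'⟫) :
    ∫ s in (0:ℝ)..L,
        (2 * ⟪deriv (deriv (deriv γ)) s, deriv (deriv γ) s⟫
          - 2 * ⟪γ s, deriv (deriv (deriv γ)) s⟫ * ⟪γ s, deriv (deriv γ) s⟫
          - 3 * ⟪γ s, deriv (deriv γ) s⟫ * ⟪deriv γ s, deriv (deriv γ) s⟫) = 0 := by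
  have hγ₁ := hγ.deriv_of_top
  have hγ₂ := hγ₁.deriv_of_top
  have hγ₃ := hγ₂.deriv_of_top
  have hasDeriv {f : ℝ → E} (hf : ContDiff ℝ (⊤ : ℕ∞) f) (s : ℝ) : HasDerivAt f (deriv f s) s :=
    (hf.differentiable (by simp) s).hasDerivAt
  have d₀ := hasDeriv hγ
  have d₁ := hasDeriv hγ₁
  have d₂ := hasDeriv hγ₂
  have orth (s : ℝ) : ⟪γ s, deriv γ s⟫ = 0 := by
    have h := (d₀ s).inner ℝ (d₀ s)
    rw [funext fun t => hconst t 0] at h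
    linarith [h.unique (hasDerivAt_const s _), real_inner_comm (γ s) (deriv γ s)]
  have second (s : ℝ) : ⟪γ s, deriv (deriv γ) s⟫ = -⟪deriv γ s, deriv γ s⟫ := by
    have h := (d₀ s).inner ℝ (d₁ s)
    rw [funext orth] at h
    linarith [h.unique (hasDerivAt_const s _)]
  have third (s : ℝ) :
      ⟪γ s, deriv (deriv (deriv γ)) s⟫ = -3 * ⟪deriv γ s, deriv (deriv γ) s⟫ := by
    have h := (d₀ s).inner ℝ (d₂ s)
    rw [funext second] at h
    linarith [h.unique ((d₁ s).inner ℝ (d₁ s)).neg,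
      real_inner_comm (deriv γ s) (deriv (deriv γ) s)]
  have primitive (s : ℝ) : HasDerivAt
      (fun t => ⟪deriv (deriv γ) t, deriv (deriv γ) t⟫ - 3 / 4 * ⟪deriv γ t, deriv γ t⟫ ^ 2)
      (2 * ⟪deriv (deriv (deriv γ)) s, deriv (deriv γ) s⟫
        - 2 * ⟪γ s, deriv (deriv (deriv γ)) s⟫ * ⟪γ s, deriv (deriv γ) s⟫
        - 3 * ⟪γ s, deriv (deriv γ) s⟫ * ⟪deriv γ s, deriv (deriv γ) s⟫) s := by
    refine (((d₂ s).inner ℝ (d₂ s)).sub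
      ((((d₁ s).inner ℝ (d₁ s)).pow 2).const_mul (3 / 4))).congr_deriv ?_
    rw [second, third, real_inner_comm (deriv (deriv (deriv γ)) s) (deriv (deriv γ) s),
      real_inner_comm (deriv γ s) (deriv (deriv γ) s)]
    push_cast
    ring
  have p₁ : Function.Periodic (deriv γ) L := Function.Periodic.deriv_periodic hper
  rw [intervalIntegral.integral_eq_sub_of_hasDerivAt fun s _ => primitive s]
  · rw [p₁.eq, p₁.deriv_periodic.eq, sub_self]
  · have c₀ := hγ.continuous
    have c₁ := hγ₁.continuous
    have c₂ := hγ₂.continuous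
    have c₃ := hγ₃.continuous
    exact Continuous.intervalIntegrable (by fun_prop) _ _
end
end

section
/- Let Λ : ℝ → M₂(ℂ) be a smooth curve of traceless Hermitian matrices with 2·tr(Λ(s)²) = 1 for all s, and suppose the curvature κ(s) := √(2·tr((Λ'(s))²)) is strictly positive. Define N(s) = Λ'(s)/κ(s), B(s) = −(i/κ(s))·[Λ(s),Λ'(s)], and the torsion τ(s) := 2·tr(N'(s)·B(s)), where [X,Y] := YX − XY. Then κ(s)²·τ(s) = −2i·tr([Λ(s),Λ'(s)]·Λ''(s)) for all s. -/
open Matrix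

noncomputable section

attribute [local instance] Matrix.normedAddCommGroup Matrix.normedSpace

/-- An entry of a differentiable matrix-valued curve is differentiable. -/
theorem differentiableAt_entry {M : ℝ → Matrix (Fin 2) (Fin 2) ℂ} {s : ℝ}
    (hM : DifferentiableAt ℝ M s) (i j : Fin 2) : DifferentiableAt ℝ (fun t => M t i j) s :=
  differentiableAt_pi.1 (differentiableAt_pi.1 hM i) j

/-- The trace of the square of a differentiable matrix-valued curve is differentiable. -/
theorem differentiableAt_trace_mul_self {M : ℝ → Matrix (Fin 2) (Fin 2) ℂ} {s : ℝ}
    (hM : DifferentiableAt ℝ M s) : DifferentiableAt ℝ (fun t => (M t * M t).trace) s := by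
  simp only [Matrix.trace_fin_two, Matrix.mul_apply, Fin.sum_univ_two]
  have h := differentiableAt_entry hM
  exact (((h 0 0).mul (h 0 0)).add ((h 0 1).mul (h 1 0))).add
    (((h 1 0).mul (h 0 1)).add ((h 1 1).mul (h 1 1)))

/-- The bracket of `X` and `Y` is orthogonal to `Y` for the trace form. -/
theorem trace_mul_bracket_right (X Y : Matrix (Fin 2) (Fin 2) ℂ) :
    (Y * bracket X Y).trace = 0 := by
  rw [bracket, mul_sub, Matrix.trace_sub, ← mul_assoc Y X Y, Matrix.trace_mul_comm (Y * X) Y,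
    sub_self]

theorem stmt_18 (Λ : ℝ → Matrix (Fin 2) (Fin 2) ℂ)
    (hΛ : ContDiff ℝ (⊤ : ℕ∞) Λ)
    (hherm : ∀ s, (Λ s).IsHermitian) (htr : ∀ s, (Λ s).trace = 0)
    (hunit : ∀ s, 2 * (Λ s * Λ s).trace = 1)
    -- `κ(s)` is the (strictly positive) curvature, `κ(s) = √(2·tr((Λ'(s))²))`
    (κ : ℝ → ℝ) (hκpos : ∀ s, 0 < κ s)
    (hκ : ∀ s, ((κ s ^ 2 : ℝ) : ℂ) = 2 * (deriv Λ s * deriv Λ s).trace)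
    -- the normal `N` and binormal `B`
    (N B : ℝ → Matrix (Fin 2) (Fin 2) ℂ)
    (hN : ∀ s, N s = ((κ s : ℂ))⁻¹ • deriv Λ s)
    (hB : ∀ s, B s = (-(Complex.I) * ((κ s : ℂ))⁻¹) • bracket (Λ s) (deriv Λ s))
    -- `τ(s)` is the torsion, `τ(s) = ⟨N'(s), B(s)⟩ = 2·tr(N'(s)·B(s))`
    (τ : ℝ → ℝ)
    (hτ : ∀ s, ((τ s : ℝ) : ℂ) = 2 * (deriv N s * B s).trace) :
    ∀ s, ((κ s ^ 2 * τ s : ℝ) : ℂ)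
      = -2 * Complex.I * (bracket (Λ s) (deriv Λ s) * deriv (deriv Λ) s).trace := by
  intro s
  have hΛ' : Differentiable ℝ (deriv Λ) :=
    ((contDiff_infty_iff_deriv.1 hΛ).2).differentiable (by simp)
  have hsq : DifferentiableAt ℝ (fun t => κ t ^ 2) s := by
    have h := (differentiableAt_trace_mul_self (hΛ' s)).const_mul (2 : ℂ)
    have h_re := Complex.reCLM.differentiableAt.comp s h
    refine h_re.congr_of_eventuallyEq (Filter.Eventually.of_forall fun t => ?_)
    simp only [Function.comp_apply, ← hκ t, Complex.reCLM_apply, Complex.ofReal_re]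
  have hκd : DifferentiableAt ℝ κ s := by
    refine (hsq.sqrt (pow_pos (hκpos s) 2).ne').congr_of_eventuallyEq
      (Filter.Eventually.of_forall fun t => ?_)
    exact (Real.sqrt_sq (hκpos t).le).symm
  have hne : (κ s : ℂ) ≠ 0 := Complex.ofReal_ne_zero.2 (hκpos s).ne'
  have hinv : DifferentiableAt ℝ (fun t => ((κ t : ℂ))⁻¹) s :=
    (Complex.ofRealCLM.differentiableAt.comp s hκd).inv hne
  have hN' : deriv N s = ((κ s : ℂ))⁻¹ • deriv (deriv Λ) s
      + deriv (fun t => ((κ t : ℂ))⁻¹) s • deriv Λ s := by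
    rw [funext hN]
    exact (hinv.hasDerivAt.smul (hΛ' s).hasDerivAt).deriv
  rw [Complex.ofReal_mul, hτ, hN', hB, Complex.ofReal_pow, add_mul, Matrix.trace_add]
  simp only [Matrix.smul_mul, Matrix.mul_smul, Matrix.trace_smul, smul_eq_mul,
    trace_mul_bracket_right, mul_zero, add_zero]
  rw [Matrix.trace_mul_comm (deriv (deriv Λ) s)]
  field_simp
end
end

section
/- Let L > 0 and let Λ : ℝ² → M₂(ℂ) be a smooth map such that s ↦ Λ(s,t) is L-periodic for every t, and such that Λ satisfies Heisenberg's magnetic equation ∂Λ/∂t = i·[∂²Λ/∂s², Λ], where [X,Y] := YX − XY. Then the total spin t ↦ ∫₀ᴸ Λ(s,t) ds is constant in t. -/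
open Matrix

noncomputable section

attribute [local instance] Matrix.normedAddCommGroup Matrix.normedSpace

theorem ContDiff.hasDerivAt_fst_partial {E : Type*} [NormedAddCommGroup E] [NormedSpace ℝ E]
    {f : ℝ × ℝ → E} (hf : ContDiff ℝ (⊤ : ℕ∞) f) (s t : ℝ) :
    HasDerivAt (fun s' => f (s', t)) (fderiv ℝ f (s, t) (1, 0)) s :=
  ((hf.differentiable (by simp)) (s, t)).hasFDerivAt.comp_hasDerivAt s
    ((hasDerivAt_id s).prodMk (hasDerivAt_const s t))

theorem ContDiff.hasDerivAt_snd_partial {E : Type*} [NormedAddCommGroup E] [NormedSpace ℝ E]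
    {f : ℝ × ℝ → E} (hf : ContDiff ℝ (⊤ : ℕ∞) f) (s t : ℝ) :
    HasDerivAt (fun t' => f (s, t')) (fderiv ℝ f (s, t) (0, 1)) t :=
  ((hf.differentiable (by simp)) (s, t)).hasFDerivAt.comp_hasDerivAt t
    ((hasDerivAt_const t s).prodMk (hasDerivAt_id t))

theorem ContDiff.fderiv_apply_const {E : Type*} [NormedAddCommGroup E] [NormedSpace ℝ E]
    {f : ℝ × ℝ → E} (hf : ContDiff ℝ (⊤ : ℕ∞) f) (v : ℝ × ℝ) :
    ContDiff ℝ (⊤ : ℕ∞) (fun p => fderiv ℝ f p v) :=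
  (hf.fderiv_right (m := (⊤ : ℕ∞)) (by simp)).clm_apply contDiff_const

/-- Differentiation under the integral sign for a smooth function of two real variables. -/
theorem ContDiff.hasDerivAt_intervalIntegral_param {E : Type*} [NormedAddCommGroup E]
    [NormedSpace ℝ E] {f : ℝ × ℝ → E} (hf : ContDiff ℝ (⊤ : ℕ∞) f) (a b t : ℝ) :
    HasDerivAt (fun t' => ∫ s in a..b, f (s, t'))
      (∫ s in a..b, fderiv ℝ f (s, t) (0, 1)) t := by
  have hc : Continuous fun p => fderiv ℝ f p (0, 1) := (hf.fderiv_apply_const (0, 1)).continuous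
  obtain ⟨C, hC⟩ := (isCompact_uIcc.prod (isCompact_closedBall t 1)).exists_bound_of_continuousOn
    (s := Set.uIcc a b ×ˢ Metric.closedBall t 1) hc.continuousOn
  refine (intervalIntegral.hasDerivAt_integral_of_dominated_loc_of_deriv_le
    (F := fun t' s => f (s, t')) (F' := fun t' s => fderiv ℝ f (s, t') (0, 1))
    (bound := fun _ => C) (Metric.closedBall_mem_nhds t one_pos) ?_ ?_ ?_ ?_ ?_ ?_).2
  · exact .of_forall fun t' =>
      (hf.continuous.comp (by fun_prop : Continuous fun s : ℝ => (s, t'))).aestronglyMeasurable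
  · exact (hf.continuous.comp (by fun_prop : Continuous fun s : ℝ => (s, t))).intervalIntegrable _ _
  · exact (hc.comp (by fun_prop : Continuous fun s : ℝ => (s, t))).aestronglyMeasurable
  · exact .of_forall fun s hs t' ht' => hC (s, t') ⟨Set.uIoc_subset_uIcc hs, ht'⟩
  · exact intervalIntegrable_const
  · exact .of_forall fun s _ t' _ => hf.hasDerivAt_snd_partial s t'

/-- If `B` is an alternating continuous bilinear map and `u` is a smooth solution of
`∂u/∂t = B (∂²u/∂s²) u` that is periodic in `s`, then the integral of `u` over a period is
independent of `t`. -/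
theorem integral_period_eq_of_alternating_bilinear {E : Type*} [NormedAddCommGroup E]
    [NormedSpace ℝ E] [CompleteSpace E] (B : E →L[ℝ] E →L[ℝ] E) (hB : ∀ x, B x x = 0) {L : ℝ}
    {u : ℝ → ℝ → E} (hu : ContDiff ℝ (⊤ : ℕ∞) (fun p : ℝ × ℝ => u p.1 p.2))
    (hper : ∀ s t, u (s + L) t = u s t)
    (heq : ∀ s t, deriv (fun t' => u s t') t
      = B (deriv (fun s' => deriv (fun s'' => u s'' t) s') s) (u s t)) (t₁ t₂ : ℝ) :
    (∫ s in (0 : ℝ)..L, u s t₁) = ∫ s in (0 : ℝ)..L, u s t₂ := by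
  have key : ∀ t, HasDerivAt (fun t' => ∫ s in (0 : ℝ)..L, u s t') 0 t := by
    intro t
    have hF := hu.hasDerivAt_intervalIntegral_param 0 L t
    have hut : ∀ s, fderiv ℝ (fun p : ℝ × ℝ => u p.1 p.2) (s, t) (0, 1)
        = deriv (fun t' => u s t') t := fun s => (hu.hasDerivAt_snd_partial s t).deriv.symm
    have hus : ∀ s, HasDerivAt (fun s' => u s' t) (deriv (fun s' => u s' t) s) s :=
      fun s => (hu.hasDerivAt_fst_partial s t).differentiableAt.hasDerivAt
    have hus' : (fun s => deriv (fun s' => u s' t) s)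
        = fun s => fderiv ℝ (fun p : ℝ × ℝ => u p.1 p.2) (s, t) (1, 0) :=
      funext fun s => (hu.hasDerivAt_fst_partial s t).deriv
    have huss : ∀ s, HasDerivAt (fun s' => deriv (fun s'' => u s'' t) s')
        (deriv (fun s' => deriv (fun s'' => u s'' t) s') s) s := by
      intro s
      rw [hus']
      exact ((hu.fderiv_apply_const (1, 0)).hasDerivAt_fst_partial s t).differentiableAt.hasDerivAt
    have hprim : ∀ s, HasDerivAt (fun s' => B (deriv (fun s'' => u s'' t) s') (u s' t))
        (fderiv ℝ (fun p : ℝ × ℝ => u p.1 p.2) (s, t) (0, 1)) s := by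
      intro s
      rw [hut, heq]
      simpa [hB] using B.hasDerivAt_of_bilinear (fun _ => huss s) (fun _ => hus s)
    have hcont : Continuous fun s => fderiv ℝ (fun p : ℝ × ℝ => u p.1 p.2) (s, t) (0, 1) :=
      (hu.fderiv_apply_const (0, 1)).continuous.comp
        (by fun_prop : Continuous fun s : ℝ => (s, t))
    have hderiv : deriv (fun s => u s t) L = deriv (fun s => u s t) 0 := by
      simpa [hper] using (deriv_comp_add_const (fun s => u s t) L 0).symm
    have hval : u L t = u 0 t := by simpa using hper 0 t
    rw [intervalIntegral.integral_eq_sub_of_hasDerivAt (fun s _ => hprim s)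
      (hcont.intervalIntegrable _ _), hderiv, hval, sub_self] at hF
    exact hF
  exact is_const_of_deriv_eq_zero (fun t => (key t).differentiableAt) (fun t => (key t).deriv) t₁ t₂

theorem isBilinearMap_I_smul_bracket :
    IsBilinearMap ℝ (fun X Y : Matrix (Fin 2) (Fin 2) ℂ => Complex.I • bracket X Y) where
  add_left X X' Y := by simp only [bracket, mul_add, add_mul, ← smul_add]; congr 1; abel
  smul_left c X Y := by
    simp only [bracket, mul_smul_comm, smul_mul_assoc, ← smul_sub, smul_comm c Complex.I]
  add_right X Y Y' := by simp only [bracket, mul_add, add_mul, ← smul_add]; congr 1; abel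
  smul_right c X Y := by
    simp only [bracket, mul_smul_comm, smul_mul_assoc, ← smul_sub, smul_comm c Complex.I]

/-- The total spin `∫₀ᴸ Λ(s,t) ds` is conserved under Heisenberg's magnetic equation. -/
theorem stmt_19 (L : ℝ) (hL : 0 < L) (Λ : ℝ → ℝ → Matrix (Fin 2) (Fin 2) ℂ)
    (hΛ : ContDiff ℝ (⊤ : ℕ∞) (fun p : ℝ × ℝ => Λ p.1 p.2))
    (hper : ∀ s t, Λ (s + L) t = Λ s t)
    (hHeis : ∀ s t, deriv (fun t' => Λ s t') t
      = Complex.I • bracket (deriv (fun s' => deriv (fun s'' => Λ s'' t) s') s) (Λ s t)) :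
    ∀ t₁ t₂, (∫ s in (0:ℝ)..L, Λ s t₁) = ∫ s in (0:ℝ)..L, Λ s t₂ := by
  refine integral_period_eq_of_alternating_bilinear
    isBilinearMap_I_smul_bracket.toContinuousBilinearMap (fun X => ?_) hΛ hper hHeis
  change Complex.I • bracket X X = 0
  simp [bracket]
end
end
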